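/- Let R = S ×_k T be a non-trivial fiber product and let M_1, N_1 be finitely generated S-modules, regarded as R-modules via the surjection R → S. Then there are isomorphisms of R-modules Tor_1^R(M_1, N_1) ≅ Tor_1^S(M_1, N_1) ⊕ (N_1/m_S N_1)^{β_1^T(k)·β_0^S(M_1)} and Tor_1^R(M_1, N_1) ≅ Tor_1^S(M_1, N_1) ⊕ (M_1/m_S M_1)^{β_1^T(k)·β_0^S(N_1)}. -/

import Mathlib

open CategoryTheory Opposite IsLocalRing

noncomputable section

/-- Vanishing of `Tor_i^A(M, N)`. -/
abbrev TorZero (A : Type) [CommRing A] (M N : Type) [AddCommGroup M] [Module A M]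
    [AddCommGroup N] [Module A N] (i : ℕ) : Prop :=
  Subsingleton (((Tor (ModuleCat A) i).obj (ModuleCat.of A M)).obj (ModuleCat.of A N))

/-- Vanishing of `Ext^i_A(M, N)`. -/
abbrev ExtZero (A : Type) [CommRing A] (M N : Type) [AddCommGroup M] [Module A M]
    [AddCommGroup N] [Module A N] (i : ℕ) : Prop :=
  Subsingleton (((Ext A (ModuleCat A) i).obj (op (ModuleCat.of A M))).obj (ModuleCat.of A N))

/-- `M` has projective dimension at most `n` over `A`:
`Ext^i_A(M, -) = 0` for all `i > n`. -/
def PdLE (A : Type) [CommRing A] (M : Type) [AddCommGroup M] [Module A M] (n : ℕ) : Prop :=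
  ∀ (N : ModuleCat A) (i : ℕ), n < i →
    Subsingleton (((Ext A (ModuleCat A) i).obj (op (ModuleCat.of A M))).obj N)

/-- `N` has injective dimension at most `n` over `A`:
`Ext^i_A(-, N) = 0` for all `i > n`. -/
def IdLE (A : Type) [CommRing A] (N : Type) [AddCommGroup N] [Module A N] (n : ℕ) : Prop :=
  ∀ (X : ModuleCat A) (i : ℕ), n < i →
    Subsingleton (((Ext A (ModuleCat A) i).obj (op X)).obj (ModuleCat.of A N))

/-- The depth of a module over a noetherian local ring, as an extended natural number:
`inf { i | Ext^i_A(k, M) ≠ 0 }`. -/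
def depthM (A : Type) [CommRing A] [IsLocalRing A] (M : Type) [AddCommGroup M]
    [Module A M] : ℕ∞ :=
  sInf {n : ℕ∞ | ∃ i : ℕ, n = i ∧
    ¬ Subsingleton (((Ext A (ModuleCat A) i).obj
        (op (ModuleCat.of A (A ⧸ maximalIdeal A)))).obj (ModuleCat.of A M))}

/-- The fiber product `S ×ₖ T` as a subring of `S × T`. -/
def fiberProd {S T k : Type} [CommRing S] [CommRing T] [CommRing k]
    (πS : S →+* k) (πT : T →+* k) : Subring (S × T) :=
  RingHom.eqLocus (πS.comp (RingHom.fst S T)) (πT.comp (RingHom.snd S T))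

/-- The projection from the fiber product to `S`. -/
def ρS {S T k : Type} [CommRing S] [CommRing T] [CommRing k]
    (πS : S →+* k) (πT : T →+* k) : ↥(fiberProd πS πT) →+* S :=
  (RingHom.fst S T).comp (fiberProd πS πT).subtype

/-- The projection from the fiber product to `T`. -/
def ρT {S T k : Type} [CommRing S] [CommRing T] [CommRing k]
    (πS : S →+* k) (πT : T →+* k) : ↥(fiberProd πS πT) →+* T :=
  (RingHom.snd S T).comp (fiberProd πS πT).subtype

/-- The `i`-th Betti number of a module `M` over a noetherian local ring `A`:
the `k`-dimension of `Tor_i^A(M, k) ⊗_A k`; since `Tor_i^A(M, k)` is annihilated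
by the maximal ideal, this is `dim_k Tor_i^A(M, k)`. -/
noncomputable def betti (A : Type) [CommRing A] [IsLocalRing A] (M : Type) [AddCommGroup M]
    [Module A M] (i : ℕ) : ℕ :=
  let X : ModuleCat A :=
    ((Tor (ModuleCat A) i).obj (ModuleCat.of A M)).obj (ModuleCat.of A (A ⧸ maximalIdeal A))
  Module.finrank (A ⧸ maximalIdeal A) (X ⧸ (maximalIdeal A • (⊤ : Submodule A X)))

open TensorProduct

section Algebra

variable {A : Type*} [CommRing A]

/-- If `X₁ → X₂ → Q → 0` is exact, the homology of `X₁ → X₂ → X₃` at `X₂` is the kernel of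
the induced map `Q → X₃`. -/
def kerQuotRangeEquivKer {X₁ X₂ X₃ Q : Type*} [AddCommGroup X₁] [AddCommGroup X₂]
    [AddCommGroup X₃] [AddCommGroup Q] [Module A X₁] [Module A X₂] [Module A X₃] [Module A Q]
    (f : X₁ →ₗ[A] X₂) (g : X₂ →ₗ[A] X₃) (q : X₂ →ₗ[A] Q) (i : Q →ₗ[A] X₃)
    (hfq : Function.Exact f q) (hq : Function.Surjective q) (hiq : i ∘ₗ q = g)
    (f' : X₁ →ₗ[A] LinearMap.ker g) (hf' : ∀ x, (f' x : X₂) = f x) :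
    (LinearMap.ker g ⧸ LinearMap.range f') ≃ₗ[A] LinearMap.ker i := by
  have hmem : ∀ x : LinearMap.ker g, q x ∈ LinearMap.ker i := by
    rintro ⟨x, hx⟩
    rw [LinearMap.mem_ker, ← LinearMap.comp_apply, hiq]
    exact hx
  let φ : LinearMap.ker g →ₗ[A] LinearMap.ker i :=
    (q ∘ₗ (LinearMap.ker g).subtype).codRestrict _ hmem
  have hφ : Function.Surjective φ := by
    rintro ⟨y, hy⟩
    obtain ⟨x, rfl⟩ := hq y
    refine ⟨⟨x, ?_⟩, rfl⟩
    rw [LinearMap.mem_ker, ← hiq]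
    exact hy
  refine (Submodule.quotEquivOfEq _ _ ?_).trans (φ.quotKerEquivOfSurjective hφ)
  ext ⟨x, hx⟩
  rw [LinearMap.mem_ker, LinearMap.mem_range, Subtype.ext_iff]
  refine Iff.trans ?_ (hfq x).symm
  simp only [Subtype.ext_iff, hf', Set.mem_range]

variable {K F M K' F' N : Type*} [AddCommGroup K] [AddCommGroup F] [AddCommGroup M]
  [AddCommGroup K'] [AddCommGroup F'] [AddCommGroup N] [Module A K] [Module A F] [Module A M]
  [Module A K'] [Module A F'] [Module A N]

/-- Balancing of the first Tor module: it can be computed from a flat presentation of either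
of its arguments. -/
def kerLTensorEquivKerRTensor [Module.Flat A F] [Module.Flat A F']
    (f : K →ₗ[A] F) (g : F →ₗ[A] N) (hf : Function.Injective f) (hfg : Function.Exact f g)
    (hg : Function.Surjective g)
    (f' : K' →ₗ[A] F') (g' : F' →ₗ[A] M) (hf' : Function.Injective f')
    (hfg' : Function.Exact f' g') (hg' : Function.Surjective g') :
    LinearMap.ker (f.lTensor M) ≃ₗ[A] LinearMap.ker (f'.rTensor N) := by
  have h₁ : f'.rTensor F ∘ₗ f.lTensor K' = f.lTensor F' ∘ₗ f'.rTensor K := by ext; simp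
  have h₂ : g'.rTensor F ∘ₗ f.lTensor F' = f.lTensor M ∘ₗ g'.rTensor K := by ext; simp
  have hι₃ : Function.Exact (LinearMap.ker (f.lTensor M)).subtype (f.lTensor M) :=
    LinearMap.exact_subtype_ker_map _
  have hι₂ : Function.Exact (0 : PUnit →ₗ[A] F' ⊗[A] K) (f.lTensor F') :=
    (LinearMap.exact_zero_iff_injective _ _).2 (Module.Flat.lTensor_preserves_injective_linearMap f hf)
  have hs := LinearMap.rTensor_surjective K hg'
  have hi := Module.Flat.rTensor_preserves_injective_linearMap (M := F) f' hf'
  let δ := SnakeLemma.δ' (f.lTensor K') (f.lTensor F') (f.lTensor M) (f'.rTensor K) (g'.rTensor K)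
    (rTensor_exact K hfg' hg') (f'.rTensor F) (g'.rTensor F) (rTensor_exact F hfg' hg') h₁ h₂
    (LinearMap.ker (f.lTensor M)).subtype hι₃ (g.lTensor K') (lTensor_exact K' hfg hg) hs hi
  have hδr : Function.Exact (0 : PUnit →ₗ[A] LinearMap.ker (f.lTensor M)) δ :=
    SnakeLemma.exact_δ'_right _ _ _ _ _ _ _ _ _ h₁ h₂ _ hι₂ _ hι₃ _ _ hs hi 0
      (by ext; simp) Subtype.val_injective
  have hδl : Function.Exact δ (f'.rTensor N) :=
    SnakeLemma.exact_δ'_left _ _ _ _ _ _ _ _ _ h₁ h₂ _ hι₃ _ _ (g.lTensor F')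
      (lTensor_exact F' hfg hg) hs hi _ (by ext; simp) (LinearMap.lTensor_surjective _ hg)
  exact (LinearEquiv.ofInjective δ ((LinearMap.exact_zero_iff_injective _ _).1 hδr)).trans
    (LinearEquiv.ofEq _ _ hδl.linearMap_ker_eq.symm)

end Algebra

section Tor

variable {A : Type} [CommRing A]

/-- `Tor₁(M, N)` as the kernel of `M ⊗ K → M ⊗ F` for some projective presentation of `N`. -/
theorem exists_presentation_tor_one (M N : ModuleCat.{0} A) :
    ∃ (K F : ModuleCat.{0} A) (f : K →ₗ[A] F) (g : F →ₗ[A] N), Module.Projective A F ∧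
      Function.Injective f ∧ Function.Exact f g ∧ Function.Surjective g ∧
      Nonempty ((((Tor (ModuleCat A) 1).obj M).obj N) ≃ₗ[A] LinearMap.ker (f.lTensor M)) := by
  let P := projectiveResolution N
  let C := P.complex
  let d := (C.d 1 0).hom
  let p : C.X 0 →ₗ[A] N := (P.π.f 0).hom
  have h0 : Function.Exact d p :=
    (ShortComplex.ShortExact.moduleCat_exact_iff_function_exact _).1 P.exact₀
  have h1 : Function.Exact (C.d 2 1).hom d :=
    (ShortComplex.ShortExact.moduleCat_exact_iff_function_exact _).1 (P.exact_succ 0)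
  have hs : Function.Surjective p :=
    (ModuleCat.epi_iff_surjective _).1 inferInstance
  have h1' : Function.Exact (C.d 2 1).hom d.rangeRestrict := by
    intro x
    rw [← h1 x, Subtype.ext_iff]; rfl
  refine ⟨ModuleCat.of A (LinearMap.range d), C.X 0, (LinearMap.range d).subtype, p,
    ?_, Subtype.val_injective, ?_, hs, ⟨?_⟩⟩
  · exact (IsProjective.iff_projective _).2 (P.projective 0)
  · intro x
    rw [h0 x]
    simp
  · let G := (MonoidalCategory.tensoringLeft (ModuleCat A)).obj M
    let D := (G.mapHomologicalComplex (ComplexShape.down ℕ)).obj C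
    let e : (((Tor (ModuleCat A) 1).obj M).obj N) ≅ (D.sc' 2 1 0).moduleCatLeftHomologyData.H :=
      P.isoLeftDerivedObj G 1 ≪≫ D.homologyIsoSc' 2 1 0 (by simp) (by simp) ≪≫
        (D.sc' 2 1 0).moduleCatHomologyIso
    let e' := kerQuotRangeEquivKer (X₁ := M ⊗[A] C.X 2) (X₂ := M ⊗[A] C.X 1) (X₃ := M ⊗[A] C.X 0)
      ((C.d 2 1).hom.lTensor M) (d.lTensor M) (d.rangeRestrict.lTensor M)
      ((LinearMap.range d).subtype.lTensor M)
      (lTensor_exact M h1' d.surjective_rangeRestrict)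
      (LinearMap.lTensor_surjective M d.surjective_rangeRestrict)
      (LinearMap.lTensor_comp M (LinearMap.range d).subtype d.rangeRestrict).symm
      (D.sc' 2 1 0).moduleCatToCycles (fun x => rfl)
    exact LinearEquiv.trans e.toLinearEquiv e'

variable (M N : Type) [AddCommGroup M] [Module A M] [AddCommGroup N] [Module A N]

/-- `Tor₁(M, N)` as the kernel of `K ⊗ N → F ⊗ N` for any flat presentation of `M`. -/
theorem nonempty_tor_one_equiv_ker_rTensor {K F : Type} [AddCommGroup K] [AddCommGroup F]
    [Module A K] [Module A F] [Module.Flat A F] (f : K →ₗ[A] F) (g : F →ₗ[A] M)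
    (hf : Function.Injective f) (hfg : Function.Exact f g) (hg : Function.Surjective g) :
    Nonempty ((((Tor (ModuleCat A) 1).obj (ModuleCat.of A M)).obj (ModuleCat.of A N)) ≃ₗ[A]
      LinearMap.ker (f.rTensor N)) := by
  obtain ⟨K', F', f', g', _, hf', hfg', hg', ⟨e⟩⟩ :=
    exists_presentation_tor_one (ModuleCat.of A M) (ModuleCat.of A N)
  exact ⟨e.trans (kerLTensorEquivKerRTensor f' g' hf' hfg' hg' f g hf hfg hg)⟩

/-- Symmetry of the first Tor module. -/
theorem nonempty_tor_one_comm :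
    Nonempty ((((Tor (ModuleCat A) 1).obj (ModuleCat.of A M)).obj (ModuleCat.of A N)) ≃ₗ[A]
      (((Tor (ModuleCat A) 1).obj (ModuleCat.of A N)).obj (ModuleCat.of A M))) := by
  obtain ⟨K, F, f, g, _, hf, hfg, hg, ⟨e⟩⟩ :=
    exists_presentation_tor_one (ModuleCat.of A M) (ModuleCat.of A N)
  obtain ⟨e'⟩ := nonempty_tor_one_equiv_ker_rTensor N M f g hf hfg hg
  have h : (LinearMap.ker (f.lTensor M)).map (TensorProduct.comm A M K).toLinearMap =
      LinearMap.ker (f.rTensor M) := by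
    rw [Submodule.map_equiv_eq_comap_symm]
    ext x
    simp [← LinearMap.comm_comp_rTensor_comp_comm_eq]
  exact ⟨e.trans (((TensorProduct.comm A M K).ofSubmodules _ _ h).trans e'.symm)⟩

end Tor

section Betti

/-- A linear equivalence computes `finrank` of the residue module. -/
theorem finrank_quot_maximalIdeal_eq {A : Type} [CommRing A] [IsLocalRing A] {X Y : Type}
    [AddCommGroup X] [Module A X] [AddCommGroup Y] [Module A Y] (e : X ≃ₗ[A] Y) :
    Module.finrank (A ⧸ maximalIdeal A) (X ⧸ (maximalIdeal A • (⊤ : Submodule A X))) =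
      Module.finrank (A ⧸ maximalIdeal A) (Y ⧸ (maximalIdeal A • (⊤ : Submodule A Y))) := by
  have h : (maximalIdeal A • (⊤ : Submodule A X)).map e.toLinearMap =
      maximalIdeal A • (⊤ : Submodule A Y) := by
    rw [Submodule.map_smul'', Submodule.map_top, LinearEquiv.range]
  exact ((Submodule.Quotient.equiv _ _ e h).extendScalarsOfSurjective
    Ideal.Quotient.mk_surjective).finrank_eq

theorem finrank_quot_smul_quot_smul {A : Type} [CommRing A] [IsLocalRing A] (M : Type)
    [AddCommGroup M] [Module A M] :
    Module.finrank (A ⧸ maximalIdeal A) ((M ⧸ (maximalIdeal A • (⊤ : Submodule A M))) ⧸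
      (maximalIdeal A • (⊤ : Submodule A (M ⧸ (maximalIdeal A • (⊤ : Submodule A M)))))) =
    Module.finrank (A ⧸ maximalIdeal A) (M ⧸ (maximalIdeal A • (⊤ : Submodule A M))) := by
  have h : maximalIdeal A • (⊤ : Submodule A (M ⧸ (maximalIdeal A • (⊤ : Submodule A M)))) = ⊥ := by
    rw [eq_bot_iff, Submodule.smul_le]
    rintro r hr x -
    obtain ⟨x, rfl⟩ := Submodule.Quotient.mk_surjective _ x
    rw [Submodule.mem_bot, ← Submodule.Quotient.mk_smul, Submodule.Quotient.mk_eq_zero]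
    exact Submodule.smul_mem_smul hr trivial
  exact ((Submodule.quotEquivOfEqBot _ h).extendScalarsOfSurjective
    Ideal.Quotient.mk_surjective).finrank_eq

theorem betti_zero (A : Type) [CommRing A] [IsLocalRing A] (M : Type) [AddCommGroup M]
    [Module A M] :
    betti A M 0 =
      Module.finrank (A ⧸ maximalIdeal A) (M ⧸ (maximalIdeal A • (⊤ : Submodule A M))) := by
  let e := (((MonoidalCategory.tensoringLeft (ModuleCat A)).obj
    (ModuleCat.of A M)).leftDerivedZeroIsoSelf.app
      (ModuleCat.of A (A ⧸ maximalIdeal A))).toLinearEquiv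
  exact (finrank_quot_maximalIdeal_eq
    (e.trans (TensorProduct.tensorQuotEquivQuotSMul M (maximalIdeal A)))).trans
      (finrank_quot_smul_quot_smul M)

theorem betti_residueField_one (A : Type) [CommRing A] [IsLocalRing A] :
    betti A (A ⧸ maximalIdeal A) 1 = Module.finrank (ResidueField A) (CotangentSpace A) := by
  obtain ⟨e⟩ := nonempty_tor_one_equiv_ker_rTensor (A ⧸ maximalIdeal A) (A ⧸ maximalIdeal A)
    (maximalIdeal A).subtype (maximalIdeal A).mkQ Subtype.val_injective
    (LinearMap.exact_subtype_mkQ _) (Submodule.mkQ_surjective _)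
  have h : (maximalIdeal A).subtype.rTensor (A ⧸ maximalIdeal A) = 0 := by
    refine TensorProduct.ext' fun x y => ?_
    obtain ⟨y, rfl⟩ := Submodule.Quotient.mk_surjective _ y
    have hx : (x : A) • (Submodule.Quotient.mk y : A ⧸ maximalIdeal A) = 0 := by
      rw [← Submodule.Quotient.mk_smul, Submodule.Quotient.mk_eq_zero]
      exact Ideal.mul_mem_right _ _ x.2
    rw [LinearMap.rTensor_tmul, Submodule.subtype_apply, ← mul_one (x : A), ← smul_eq_mul,
      TensorProduct.smul_tmul, hx, TensorProduct.tmul_zero, LinearMap.zero_apply]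
  let e' := e.trans ((LinearEquiv.ofTop _ (by rw [h, LinearMap.ker_zero])).trans
    (TensorProduct.tensorQuotEquivQuotSMul (maximalIdeal A) (maximalIdeal A)))
  exact (finrank_quot_maximalIdeal_eq e').trans (finrank_quot_smul_quot_smul (maximalIdeal A))

end Betti

section ChangeOfRings

/-- A minimal free cover of a finitely generated module over a local ring. -/
theorem exists_minimal_presentation (S : Type) [CommRing S] [IsLocalRing S] (M : Type)
    [AddCommGroup M] [Module S M] [Module.Finite S M] :
    ∃ g : (Fin (betti S M 0) → S) →ₗ[S] M, Function.Surjective g ∧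
      ∀ x, g x = 0 → ∀ i, x i ∈ maximalIdeal S := by
  let _ : Field (S ⧸ maximalIdeal S) := Ideal.Quotient.field (maximalIdeal S)
  let b : Module.Basis (Fin (betti S M 0)) (S ⧸ maximalIdeal S)
      (M ⧸ (maximalIdeal S • (⊤ : Submodule S M))) :=
    Module.finBasisOfFinrankEq _ _ (betti_zero S M).symm
  choose v hv using fun i => Submodule.Quotient.mk_surjective _ (b i)
  have hmk : ∀ x : Fin (betti S M 0) → S,
      (Submodule.Quotient.mk (Fintype.linearCombination S v x) :
        M ⧸ (maximalIdeal S • (⊤ : Submodule S M))) =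
      ∑ i, Ideal.Quotient.mk (maximalIdeal S) (x i) • b i := by
    intro x
    rw [Fintype.linearCombination_apply, ← Submodule.mkQ_apply, map_sum]
    refine Finset.sum_congr rfl fun i _ => ?_
    rw [map_smul, Submodule.mkQ_apply, hv]
    rfl
  refine ⟨Fintype.linearCombination S v, ?_, ?_⟩
  · rw [← LinearMap.range_eq_top, eq_top_iff]
    refine Submodule.le_of_le_smul_of_le_jacobson_bot Module.Finite.fg_top
      (maximalIdeal_le_jacobson _) fun x _ => ?_
    choose s hs using fun i => Ideal.Quotient.mk_surjective (b.repr (Submodule.Quotient.mk x) i)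
    rw [← add_sub_cancel (Fintype.linearCombination S v s) x]
    refine Submodule.add_mem_sup ⟨s, rfl⟩ ?_
    rw [← Submodule.Quotient.mk_eq_zero, Submodule.Quotient.mk_sub, hmk, sub_eq_zero]
    simp only [hs]
    exact (b.sum_repr _).symm
  · intro x hx i
    have h := hmk x
    rw [hx, Submodule.Quotient.mk_zero] at h
    exact Ideal.Quotient.eq_zero_iff_mem.1
      (Fintype.linearIndependent_iff.1 b.linearIndependent _ h.symm i)

variable {R S : Type} [CommRing R] [CommRing S] [Algebra R S]
  (N : Type) [AddCommGroup N] [Module R N] [Module S N] [IsScalarTower R S N]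

/-- If `p : J → (S ⧸ m)ᵈ` is onto with kernel `J²`, where `J` is the kernel of `R → S`, then
`J ⊗ N ≅ (N ⧸ m N)ᵈ` for each `S`-module `N`. -/
def kerTensorEquivPi (hsurj : Function.Surjective (algebraMap R S)) (m : Ideal S) {d : ℕ}
    (p : RingHom.ker (algebraMap R S) →ₗ[R] (Fin d → S ⧸ m)) (hp : Function.Surjective p)
    (hker : LinearMap.ker p ≤ RingHom.ker (algebraMap R S) • ⊤) :
    RingHom.ker (algebraMap R S) ⊗[R] N ≃ₗ[R] (Fin d → N ⧸ (m • (⊤ : Submodule S N))) := by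
  haveI : CompatibleSMul R S (S ⧸ m) N := CompatibleSMul.of_algebraMap_surjective _ _ hsurj
  have hinj : Function.Injective (p.rTensor N) := by
    rw [← LinearMap.exact_zero_iff_injective PUnit]
    have h := rTensor_exact N (LinearMap.exact_subtype_ker_map p) hp
    have h0 : (LinearMap.ker p).subtype.rTensor N = 0 := by
      refine TensorProduct.ext' fun x y => ?_
      rw [LinearMap.rTensor_tmul, LinearMap.zero_apply, Submodule.subtype_apply]
      refine Submodule.smul_induction_on (p := fun z => z ⊗ₜ[R] y = 0) (hker x.2) ?_ ?_
      · intro r hr z _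
        rw [TensorProduct.smul_tmul, ← algebraMap_smul S r y, (RingHom.mem_ker).1 hr, zero_smul,
          TensorProduct.tmul_zero]
      · intro a b ha hb
        rw [TensorProduct.add_tmul, ha, hb, add_zero]
    intro z
    rw [h z, h0]
    simp
  exact (LinearEquiv.ofBijective _ ⟨hinj, LinearMap.rTensor_surjective N hp⟩).trans
    ((TensorProduct.piLeft R N (fun _ : Fin d => S ⧸ m)).trans
      (LinearEquiv.piCongrRight fun _ =>
        ((TensorProduct.equivOfCompatibleSMul R S R (S ⧸ m) N).symm.trans
          ((TensorProduct.quotTensorEquivQuotSMul N m).restrictScalars R))))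

/-- Change of rings for `Tor₁` along a surjection `R → S` with kernel `J` such that the maximal
ideal of `S` lifts to `R` and `J ⧸ J²` is a vector space of dimension `d`. -/
theorem exists_tor_one_change_of_rings [IsLocalRing S]
    (M : Type) [AddCommGroup M] [Module R M] [Module S M] [IsScalarTower R S M] [Module.Finite S M]
    (hsurj : Function.Surjective (algebraMap R S))
    (σ : maximalIdeal S →ₗ[R] R) (hσ : ∀ x, algebraMap R S (σ x) = x) {d : ℕ}
    (p : RingHom.ker (algebraMap R S) →ₗ[R] (Fin d → S ⧸ maximalIdeal S))
    (hp : Function.Surjective p)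
    (hker : LinearMap.ker p ≤ RingHom.ker (algebraMap R S) • ⊤) :
    ∃ e : (((Tor (ModuleCat R) 1).obj (ModuleCat.of R M)).obj (ModuleCat.of R N)) ≃+
        (((Tor (ModuleCat S) 1).obj (ModuleCat.of S M)).obj (ModuleCat.of S N)) ×
          (Fin (d * betti S M 0) → N ⧸ (maximalIdeal S • (⊤ : Submodule S N))),
      ∀ (r : R) x, e (r • x) = algebraMap R S r • e x := by
  have hmin := exists_minimal_presentation S M
  generalize betti S M 0 = n at hmin ⊢
  obtain ⟨g, hg, hgm⟩ := hmin
  let J := RingHom.ker (algebraMap R S)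
  let K := LinearMap.ker g
  let f : K →ₗ[S] (Fin n → S) := K.subtype
  let π : (Fin n → R) →ₗ[R] (Fin n → S) := (Algebra.linearMap R S).compLeft (Fin n)
  have hπ : ∀ x i, π x i = algebraMap R S (x i) := fun x i => rfl
  let gR : (Fin n → R) →ₗ[R] M := g.restrictScalars R ∘ₗ π
  let σK : K →ₗ[R] (Fin n → R) := LinearMap.pi fun i => σ ∘ₗ
    ((LinearMap.proj i ∘ₗ f).restrictScalars R).codRestrict
      ((maximalIdeal S).restrictScalars R) fun x => hgm x x.2 i
  have hσK : ∀ x i, algebraMap R S (σK x i) = (x : Fin n → S) i := fun x i => hσ _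
  let ιJ : (Fin n → J) →ₗ[R] (Fin n → R) := J.subtype.compLeft (Fin n)
  have hιJ : ∀ y i, algebraMap R S (ιJ y i) = 0 := fun y i => (y i).2
  let φ : (K × (Fin n → J)) →ₗ[R] (Fin n → R) := σK.coprod ιJ
  have hπφ : ∀ z, π (φ z) = z.1 := by
    intro z
    ext i
    rw [hπ, LinearMap.coprod_apply, Pi.add_apply, map_add, hσK, hιJ, add_zero]
  have hφ : Function.Injective φ := by
    rw [injective_iff_map_eq_zero]
    rintro ⟨x, y⟩ h
    have hx : x = 0 := Subtype.ext (by rw [← hπφ (x, y), h, map_zero]; rfl)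
    subst hx
    rw [LinearMap.coprod_apply, map_zero, zero_add] at h
    have hy : y = 0 := funext fun i => Subtype.ext (congrFun h i)
    rw [hy]
    rfl
  have hgR : Function.Surjective gR := by
    intro m
    obtain ⟨s, rfl⟩ := hg m
    choose r hr using fun i => hsurj (s i)
    exact ⟨r, congrArg g (funext hr)⟩
  have hex : Function.Exact φ gR := by
    intro x
    constructor
    · intro hx
      have hxK : π x ∈ K := hx
      refine ⟨(⟨π x, hxK⟩, fun i => ⟨x i - σK ⟨π x, hxK⟩ i, ?_⟩), ?_⟩
      · rw [RingHom.mem_ker, map_sub, hσK, ← hπ, sub_self]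
      · ext i
        exact add_sub_cancel _ _
    · rintro ⟨z, rfl⟩
      change g (π (φ z)) = 0
      rw [hπφ]
      exact z.1.2
  obtain ⟨e₁⟩ := nonempty_tor_one_equiv_ker_rTensor M N φ gR hφ hex hgR
  obtain ⟨e₂⟩ := nonempty_tor_one_equiv_ker_rTensor M N f g Subtype.val_injective
    (LinearMap.exact_subtype_ker_map g) hg
  have : CompatibleSMul R S K N := CompatibleSMul.of_algebraMap_surjective _ _ hsurj
  let E : (K × (Fin n → J)) ⊗[R] N ≃ₗ[R] (K ⊗[S] N) × (Fin n → J ⊗[R] N) :=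
    (TensorProduct.prodLeft R R K (Fin n → J) N).trans
      ((TensorProduct.equivOfCompatibleSMul R S R K N).symm.prodCongr
        (TensorProduct.piLeft R N (fun _ : Fin n => J)))
  let ξ : (Fin n → R) ⊗[R] N ≃ₗ[R] (Fin n → N) :=
    (TensorProduct.comm R _ N).trans (TensorProduct.piScalarRight R R N (Fin n))
  let η : (Fin n → S) ⊗[S] N ≃ₗ[S] (Fin n → N) :=
    (TensorProduct.comm S _ N).trans (TensorProduct.piScalarRight S S N (Fin n))
  have hE : ∀ z, ξ (φ.rTensor N z) = η (f.rTensor N (E z).1) := by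
    intro z
    induction z with
    | zero => simp
    | add a b ha hb => rw [map_add, map_add, ha, hb, map_add, Prod.fst_add, map_add, map_add]
    | tmul x y =>
      ext i
      have h1 : ξ (φ.rTensor N (x ⊗ₜ y)) i = φ x i • y := by simp [ξ]
      have h2 : η (f.rTensor N (E (x ⊗ₜ y)).1) i = (x.1 : Fin n → S) i • y := by
        change η (f.rTensor N (x.1 ⊗ₜ y)) i = _
        simp [η, f]
      rw [h1, h2, ← hπφ, hπ, algebraMap_smul]
  have hE' : ∀ z, z ∈ LinearMap.ker (φ.rTensor N) ↔
      (E z).1 ∈ LinearMap.ker (f.rTensor N) := by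
    intro z
    rw [LinearMap.mem_ker, LinearMap.mem_ker, ← ξ.map_eq_zero_iff, hE, η.map_eq_zero_iff]
  let e₃ : LinearMap.ker (φ.rTensor N) ≃ₗ[R]
      LinearMap.ker (f.rTensor N) × (Fin n → J ⊗[R] N) :=
    { toFun := fun z => (⟨(E z).1, (hE' z).1 z.2⟩, (E z).2)
      invFun := fun w => ⟨E.symm (w.1, w.2), (hE' _).2 (by rw [E.apply_symm_apply]; exact w.1.2)⟩
      left_inv := fun z => Subtype.ext (E.symm_apply_apply z)
      right_inv := fun w => by
        have h := E.apply_symm_apply ((w.1 : K ⊗[S] N), w.2)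
        exact Prod.ext (Subtype.ext (Prod.ext_iff.1 h).1) (Prod.ext_iff.1 h).2
      map_add' := fun z w => by
        have h := E.map_add z w
        exact Prod.ext (Subtype.ext (Prod.ext_iff.1 h).1) (Prod.ext_iff.1 h).2
      map_smul' := fun r z => by
        have h := E.map_smul r z
        exact Prod.ext (Subtype.ext (Prod.ext_iff.1 h).1) (Prod.ext_iff.1 h).2 }
  let e₄ : (Fin n → J ⊗[R] N) ≃ₗ[R]
      (Fin (d * n) → N ⧸ (maximalIdeal S • (⊤ : Submodule S N))) :=
    (LinearEquiv.piCongrRight fun _ => kerTensorEquivPi N hsurj _ p hp hker).trans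
      ((LinearEquiv.curry R _ (Fin n) (Fin d)).symm.trans
        (LinearEquiv.funCongrLeft R _ (finProdFinEquiv.symm.trans (Equiv.prodComm _ _))))
  refine ⟨((e₁.trans e₃).toAddEquiv.trans (e₂.symm.toAddEquiv.prodCongr e₄.toAddEquiv)), ?_⟩
  intro r x
  refine Prod.ext ?_ ?_
  · change e₂.symm (e₃ (e₁ (r • x))).1 = algebraMap R S r • e₂.symm (e₃ (e₁ x)).1
    rw [map_smul, map_smul, Prod.smul_fst, ← map_smul, algebraMap_smul]
  · change e₄ (e₃ (e₁ (r • x))).2 = algebraMap R S r • e₄ (e₃ (e₁ x)).2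
    rw [map_smul, map_smul, Prod.smul_snd, map_smul, algebraMap_smul]

end ChangeOfRings

section FiberProduct

/-- The kernel of the projection `S ×ₖ T → S` maps onto the coordinate space of the cotangent
space of `T`, and the kernel of this map is its square. -/
theorem exists_ker_fiberProd_to_pi {S T k : Type} [CommRing S] [CommRing T] [Field k]
    [IsNoetherianRing T] [IsLocalRing S] [IsLocalRing T] (πS : S →+* k) (πT : T →+* k)
    (hπS : Function.Surjective πS) (hπT : Function.Surjective πT)
    (hkS : RingHom.ker πS = maximalIdeal S) (hkT : RingHom.ker πT = maximalIdeal T) :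
    letI : Algebra ↥(fiberProd πS πT) S := (ρS πS πT).toAlgebra
    ∃ p : RingHom.ker (algebraMap ↥(fiberProd πS πT) S) →ₗ[↥(fiberProd πS πT)]
        (Fin (betti T (T ⧸ maximalIdeal T) 1) → S ⧸ maximalIdeal S),
      Function.Surjective p ∧
        LinearMap.ker p ≤ RingHom.ker (algebraMap ↥(fiberProd πS πT) S) • ⊤ := by
  let _ : Algebra ↥(fiberProd πS πT) S := (ρS πS πT).toAlgebra
  let J := RingHom.ker (algebraMap ↥(fiberProd πS πT) S)
  let b : Module.Basis (Fin (betti T (T ⧸ maximalIdeal T) 1)) (ResidueField T)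
      (CotangentSpace T) :=
    Module.finBasisOfFinrankEq _ _ (betti_residueField_one T).symm
  let θS : S ⧸ maximalIdeal S ≃+* k :=
    (Ideal.quotEquivOfEq hkS.symm).trans (RingHom.quotientKerEquivOfSurjective hπS)
  let θT : ResidueField T ≃+* k :=
    (Ideal.quotEquivOfEq hkT.symm).trans (RingHom.quotientKerEquivOfSurjective hπT)
  let θ : ResidueField T ≃+* S ⧸ maximalIdeal S := θT.trans θS.symm
  have hθ : ∀ (s : S) (t : T), πS s = πT t → θ (residue T t) = Ideal.Quotient.mk _ s :=
    fun s t hst => θS.symm_apply_eq.2 hst.symm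
  have hfst : ∀ x : J, (x : S × T).1 = 0 := fun x => x.2
  have hsnd : ∀ x : J, (x : S × T).2 ∈ maximalIdeal T := by
    intro x
    have h : πS (x : S × T).1 = πT (x : S × T).2 := x.1.2
    rw [hfst, map_zero] at h
    rw [← hkT, RingHom.mem_ker, ← h]
  have hlift : ∀ t ∈ maximalIdeal T, ∃ x : J, (x : S × T).2 = t := by
    intro t ht
    rw [← hkT, RingHom.mem_ker] at ht
    exact ⟨⟨⟨(0, t), (map_zero πS).trans ht.symm⟩, rfl⟩, rfl⟩
  let c : J →+ CotangentSpace T :=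
    { toFun := fun x => (maximalIdeal T).toCotangent ⟨(x : S × T).2, hsnd x⟩
      map_zero' := map_zero (maximalIdeal T).toCotangent
      map_add' := fun x y => map_add (maximalIdeal T).toCotangent ⟨(x : S × T).2, hsnd x⟩
        ⟨(y : S × T).2, hsnd y⟩ }
  have hc : ∀ (r : ↥(fiberProd πS πT)) (x : J),
      c (r • x) = residue T (r : S × T).2 • c x := fun r x =>
    map_smul (maximalIdeal T).toCotangent (r : S × T).2 ⟨(x : S × T).2, hsnd x⟩
  refine ⟨{ toFun := fun x i => θ (b.equivFun (c x) i)
            map_add' := fun x y => ?_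
            map_smul' := fun r x => ?_ }, ?_, ?_⟩
  · ext i
    simp only [map_add, Pi.add_apply]
  · ext i
    rw [hc, map_smul, Pi.smul_apply, smul_eq_mul, map_mul, hθ (r : S × T).1 (r : S × T).2 r.2]
    rfl
  · intro y
    obtain ⟨⟨t, ht⟩, h⟩ := (maximalIdeal T).toCotangent_surjective
      (b.equivFun.symm fun i => θ.symm (y i))
    obtain ⟨x, rfl⟩ := hlift t ht
    refine ⟨x, funext fun i => ?_⟩
    have hx : c x = b.equivFun.symm fun i => θ.symm (y i) := h
    change θ (b.equivFun (c x) i) = y i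
    rw [hx, LinearEquiv.apply_symm_apply, RingEquiv.apply_symm_apply]
  · intro x hx
    have hcx : c x = 0 := by
      rw [← b.equivFun.map_eq_zero_iff]
      ext i
      exact (map_eq_zero_iff θ θ.injective).1 (congrFun hx i)
    have hsq : (x : S × T).2 ∈ maximalIdeal T • maximalIdeal T := by
      have := ((maximalIdeal T).toCotangent_eq_zero ⟨(x : S × T).2, hsnd x⟩).1 hcx
      rwa [pow_two] at this
    have key : ∃ z ∈ (J • ⊤ : Submodule ↥(fiberProd πS πT) J), (z : S × T).2 = (x : S × T).2 := by
      refine Submodule.smul_induction_on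
        (p := fun t => ∃ z ∈ (J • ⊤ : Submodule ↥(fiberProd πS πT) J), (z : S × T).2 = t) hsq ?_ ?_
      · intro s hs t ht
        obtain ⟨u, rfl⟩ := hlift s hs
        obtain ⟨v, rfl⟩ := hlift t ht
        exact ⟨(u : ↥(fiberProd πS πT)) • v, Submodule.smul_mem_smul u.2 trivial, rfl⟩
      · rintro _ _ ⟨u, hu, rfl⟩ ⟨v, hv, rfl⟩
        exact ⟨u + v, add_mem hu hv, rfl⟩
    obtain ⟨z, hz, hzx⟩ := key
    have hzx' : z = x :=
      Subtype.ext (Subtype.ext (Prod.ext ((hfst z).trans (hfst x).symm) hzx))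
    rwa [← hzx']

/-- The first Tor module over `S ×ₖ T` of two `S`-modules. -/
theorem exists_tor_one_fiberProd {S T k : Type} [CommRing S] [CommRing T] [Field k]
    [IsNoetherianRing T] [IsLocalRing S] [IsLocalRing T] (πS : S →+* k) (πT : T →+* k)
    (hπS : Function.Surjective πS) (hπT : Function.Surjective πT)
    (hkS : RingHom.ker πS = maximalIdeal S) (hkT : RingHom.ker πT = maximalIdeal T)
    (M N : Type) [AddCommGroup M] [Module S M] [Module.Finite S M]
    [AddCommGroup N] [Module S N] :
    letI : Module ↥(fiberProd πS πT) M := Module.compHom M (ρS πS πT)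
    letI : Module ↥(fiberProd πS πT) N := Module.compHom N (ρS πS πT)
    ∃ e : (((Tor (ModuleCat ↥(fiberProd πS πT)) 1).obj
          (ModuleCat.of ↥(fiberProd πS πT) M)).obj (ModuleCat.of ↥(fiberProd πS πT) N)) ≃+
        (((Tor (ModuleCat S) 1).obj (ModuleCat.of S M)).obj (ModuleCat.of S N)) ×
          (Fin (betti T (T ⧸ maximalIdeal T) 1 * betti S M 0) →
            N ⧸ (maximalIdeal S • (⊤ : Submodule S N))),
      ∀ (r : ↥(fiberProd πS πT)) x, e (r • x) = ρS πS πT r • e x := by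
  let _ : Algebra ↥(fiberProd πS πT) S := (ρS πS πT).toAlgebra
  let _ : Module ↥(fiberProd πS πT) M := Module.compHom M (ρS πS πT)
  let _ : Module ↥(fiberProd πS πT) N := Module.compHom N (ρS πS πT)
  have : IsScalarTower ↥(fiberProd πS πT) S M := IsScalarTower.of_algebraMap_smul fun _ _ => rfl
  have : IsScalarTower ↥(fiberProd πS πT) S N := IsScalarTower.of_algebraMap_smul fun _ _ => rfl
  obtain ⟨p, hp, hker⟩ := exists_ker_fiberProd_to_pi πS πT hπS hπT hkS hkT
  have hsurj : Function.Surjective (algebraMap ↥(fiberProd πS πT) S) := by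
    intro s
    obtain ⟨t, ht⟩ := hπT (πS s)
    exact ⟨⟨(s, t), ht.symm⟩, rfl⟩
  let σ : maximalIdeal S →ₗ[↥(fiberProd πS πT)] ↥(fiberProd πS πT) :=
    { toFun := fun x => ⟨((x : S), 0), by
        have hx : πS x = 0 := by rw [← RingHom.mem_ker, hkS]; exact x.2
        exact hx.trans (map_zero πT).symm⟩
      map_add' := fun x y => Subtype.ext (Prod.ext rfl (add_zero 0).symm)
      map_smul' := fun r x => Subtype.ext (Prod.ext rfl (mul_zero _).symm) }
  exact exists_tor_one_change_of_rings N M hsurj σ (fun _ => rfl) p hp hker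

end FiberProduct

/-- Lemma 2.3 (first pair of isomorphisms): for finitely generated `S`-modules `M₁, N₁`,
regarded as modules over the fiber product `R = S ×ₖ T` via `R → S`,
`Tor_1^R(M₁,N₁) ≅ Tor_1^S(M₁,N₁) ⊕ (N₁/m_S N₁)^{β_1^T(k)·β_0^S(M₁)}`
`≅ Tor_1^S(M₁,N₁) ⊕ (M₁/m_S M₁)^{β_1^T(k)·β_0^S(N₁)}`. -/
theorem stmt_2 (S T k : Type) [CommRing S] [CommRing T] [Field k]
    [IsNoetherianRing S] [IsNoetherianRing T] [IsLocalRing S] [IsLocalRing T]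
    (πS : S →+* k) (πT : T →+* k)
    (hπS : Function.Surjective πS) (hπT : Function.Surjective πT)
    (hkS : RingHom.ker πS = maximalIdeal S) (hkT : RingHom.ker πT = maximalIdeal T)
    (hS : maximalIdeal S ≠ ⊥) (hT : maximalIdeal T ≠ ⊥)
    (M1 N1 : Type) [AddCommGroup M1] [Module S M1] [Module.Finite S M1]
    [AddCommGroup N1] [Module S N1] [Module.Finite S N1] :
    letI : Module ↥(fiberProd πS πT) M1 := Module.compHom M1 (ρS πS πT)
    letI : Module ↥(fiberProd πS πT) N1 := Module.compHom N1 (ρS πS πT)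
    letI : Module ↥(fiberProd πS πT)
        (((Tor (ModuleCat S) 1).obj (ModuleCat.of S M1)).obj (ModuleCat.of S N1)) :=
      Module.compHom _ (ρS πS πT)
    letI : Module ↥(fiberProd πS πT) (N1 ⧸ (maximalIdeal S • (⊤ : Submodule S N1))) :=
      Module.compHom _ (ρS πS πT)
    letI : Module ↥(fiberProd πS πT) (M1 ⧸ (maximalIdeal S • (⊤ : Submodule S M1))) :=
      Module.compHom _ (ρS πS πT)
    (Nonempty
      ((((Tor (ModuleCat ↥(fiberProd πS πT)) 1).obj
          (ModuleCat.of ↥(fiberProd πS πT) M1)).obj (ModuleCat.of ↥(fiberProd πS πT) N1))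
        ≃ₗ[↥(fiberProd πS πT)]
        ((((Tor (ModuleCat S) 1).obj (ModuleCat.of S M1)).obj (ModuleCat.of S N1)) ×
          (Fin (betti T (T ⧸ maximalIdeal T) 1 * betti S M1 0) →
            N1 ⧸ (maximalIdeal S • (⊤ : Submodule S N1)))))) ∧
    (Nonempty
      ((((Tor (ModuleCat ↥(fiberProd πS πT)) 1).obj
          (ModuleCat.of ↥(fiberProd πS πT) M1)).obj (ModuleCat.of ↥(fiberProd πS πT) N1))
        ≃ₗ[↥(fiberProd πS πT)]
        ((((Tor (ModuleCat S) 1).obj (ModuleCat.of S M1)).obj (ModuleCat.of S N1)) ×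
          (Fin (betti T (T ⧸ maximalIdeal T) 1 * betti S N1 0) →
            M1 ⧸ (maximalIdeal S • (⊤ : Submodule S M1)))))) := by
  let _ : Module ↥(fiberProd πS πT) M1 := Module.compHom M1 (ρS πS πT)
  let _ : Module ↥(fiberProd πS πT) N1 := Module.compHom N1 (ρS πS πT)
  let _ : Module ↥(fiberProd πS πT)
      (((Tor (ModuleCat S) 1).obj (ModuleCat.of S M1)).obj (ModuleCat.of S N1)) :=
    Module.compHom _ (ρS πS πT)
  let _ : Module ↥(fiberProd πS πT) (N1 ⧸ (maximalIdeal S • (⊤ : Submodule S N1))) :=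
    Module.compHom _ (ρS πS πT)
  let _ : Module ↥(fiberProd πS πT) (M1 ⧸ (maximalIdeal S • (⊤ : Submodule S M1))) :=
    Module.compHom _ (ρS πS πT)
  obtain ⟨e, he⟩ := exists_tor_one_fiberProd πS πT hπS hπT hkS hkT M1 N1
  obtain ⟨e', he'⟩ := exists_tor_one_fiberProd πS πT hπS hπT hkS hkT N1 M1
  obtain ⟨cR⟩ := nonempty_tor_one_comm (A := ↥(fiberProd πS πT)) M1 N1
  obtain ⟨cS⟩ := nonempty_tor_one_comm (A := S) N1 M1
  refine ⟨⟨e.toLinearEquiv he⟩, ⟨cR.trans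
    ((e'.trans (cS.toAddEquiv.prodCongr (AddEquiv.refl _))).toLinearEquiv fun r x => ?_)⟩⟩
  refine Prod.ext ?_ ?_
  · change cS (e' (r • x)).1 = ρS πS πT r • cS (e' x).1
    rw [he', Prod.smul_fst, map_smul]
  · change (e' (r • x)).2 = ρS πS πT r • (e' x).2
    rw [he', Prod.smul_snd]
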